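/- arXiv:2004.11188 — 2 statements merged into one kernel-verified Lean document; each statement's English description precedes it below -/
import Mathlib

section
/- Let $E$ be a Banach space, $T>0$, $0<\mu<1$, $0<\lambda\le 1$, $M>0$, $x_0\in E$. Let $S:(0,T]\to\mathcal B(E)$ and $P:[0,T]\to\mathcal B(E)$ be strongly continuous families of bounded linear operators with $\|S(t)\|\le M t^{\lambda-1}/\Gamma(\lambda)$ and $\|P(t)\|\le M/\Gamma(\mu)$, and let $g:[0,T]\times E\to E$ satisfy: $t\mapsto g(t,x)$ strongly measurable, $x\mapsto g(t,x)$ continuous, and $\|g(t,x)-g(t,y)\|\le L\, t^{1-\lambda}\|x-y\|$ for all $x,y\in E$, $L>0$. For continuous functions $\tilde x:[0,T]\to E$ write $x(t)=t^{\lambda-1}\tilde x(t)$ and define $(\mathcal G x)(t)=S(t)x_0+\int_0^t(t-s)^{\mu-1}P(t-s)g(s,x(s))\,ds$. Then for every $r>0$ and all such $x,y$, $\sup_{t\in(0,T]} t^{1-\lambda}e^{-rt}\|(\mathcal G x)(t)-(\mathcal G y)(t)\| \le M L T^{1-\lambda} r^{-\mu}\, \sup_{t\in(0,T]} t^{1-\lambda}e^{-rt}\|x(t)-y(t)\|$.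 In particular, if $r^{\mu} > 2 M L T^{1-\lambda}$ then $\mathcal G$ is a contraction with constant $1/2$ in the weighted norm $\|x\|_r=\sup_{t\in(0,T]} t^{1-\lambda}e^{-rt}\|x(t)\|$. -/
open MeasureTheory Set Filter

/-- Superposition with a Carathéodory function preserves a.e. strong measurability. -/
theorem aestronglyMeasurable_caratheodory_comp {α E F : Type*} [MeasurableSpace α]
    {ν : Measure α} [TopologicalSpace E] [NormedAddCommGroup F]
    {u : α → E → F} {f : α → E} (hu : ∀ x, AEStronglyMeasurable (fun a => u a x) ν)
    (hc : ∀ᵐ a ∂ν, Continuous (u a)) (hf : AEStronglyMeasurable f ν) :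
    AEStronglyMeasurable (fun a => u a (f a)) ν := by
  obtain ⟨f', hf', hff'⟩ := hf
  suffices h : AEStronglyMeasurable (fun a => u a (f' a)) ν by
    refine h.congr ?_
    filter_upwards [hff'] with a ha
    rw [ha]
  refine aestronglyMeasurable_of_tendsto_ae atTop
    (f := fun n a => u a (hf'.approx n a)) (fun n => ?_) ?_
  · set φ := hf'.approx n
    have hsum : (fun a => u a (φ a)) =
        ∑ x ∈ φ.range, (φ ⁻¹' {x}).indicator (fun a => u a x) := by
      funext a
      rw [Finset.sum_apply, Finset.sum_eq_single (φ a)]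
      · simp
      · intro x _ hx
        exact indicator_of_notMem (fun h => hx h.symm) _
      · intro h
        exact absurd (φ.mem_range_self a) h
    rw [hsum]
    exact Finset.aestronglyMeasurable_sum _ fun x _ =>
      (hu x).indicator (φ.measurableSet_fiber x)
  · filter_upwards [hc] with a ha
    exact (ha.tendsto _).comp (hf'.tendsto_approx a)

/-- If `‖f - g‖` is dominated by an integrable `h`, the integrals of `f` and `g` differ by at most
the integral of `h`. No integrability of `f` or `g` is needed: either both are integrable, or both
integrals take the default value `0`. -/
theorem norm_intervalIntegral_sub_le_of_norm_sub_le {E : Type*} [NormedAddCommGroup E]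
    [NormedSpace ℝ E] {a b : ℝ} (hab : a ≤ b) {f g : ℝ → E} {h : ℝ → ℝ}
    (hm : AEStronglyMeasurable (fun s => f s - g s) (volume.restrict (Ioo a b)))
    (hh : IntervalIntegrable h volume a b) (hle : ∀ s ∈ Ioo a b, ‖f s - g s‖ ≤ h s) :
    ‖(∫ s in a..b, f s) - ∫ s in a..b, g s‖ ≤ ∫ s in a..b, h s := by
  have hle' : ∀ᵐ s ∂volume.restrict (Ioo a b), ‖f s - g s‖ ≤ h s :=
    (ae_restrict_iff' measurableSet_Ioo).2 (.of_forall hle)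
  rw [intervalIntegrable_iff_integrableOn_Ioo_of_le hab] at hh
  have hd : IntegrableOn (fun s => f s - g s) (Ioo a b) := Integrable.mono' hh hm hle'
  simp only [intervalIntegral.integral_of_le hab, integral_Ioc_eq_integral_Ioo]
  by_cases hg : IntegrableOn g (Ioo a b)
  · have hf : IntegrableOn f (Ioo a b) := 
      (hd.add hg).congr (.of_forall fun s => by simp)
    rw [← integral_sub hf hg]
    exact norm_integral_le_of_norm_le hh hle'
  · have hf : ¬ IntegrableOn f (Ioo a b) := fun hf =>
      hg ((hf.sub hd).congr (.of_forall fun s => by simp))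
    rw [integral_undef hf, integral_undef hg, sub_zero, norm_zero]
    exact integral_nonneg_of_ae (hle'.mono fun s hs => (norm_nonneg _).trans hs)

theorem integrableOn_rpow_mul_exp_neg_mul_Ioi {μ r : ℝ} (hμ : 0 < μ) (hr : 0 < r) :
    IntegrableOn (fun u : ℝ => u ^ (μ - 1) * Real.exp (-(r * u))) (Ioi 0) := by
  refine Integrable.of_integral_ne_zero ?_
  rw [Real.integral_rpow_mul_exp_neg_mul_Ioi hμ hr]
  have := Real.Gamma_pos_of_pos hμ
  positivity

theorem rpow_sub_mul_exp_eq (μ r t s : ℝ) :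
    (t - s) ^ (μ - 1) * Real.exp (r * s) =
      Real.exp (r * t) * ((t - s) ^ (μ - 1) * Real.exp (-(r * (t - s)))) := by
  rw [mul_left_comm, ← Real.exp_add]
  ring_nf

theorem intervalIntegrable_rpow_sub_mul_exp {μ r t : ℝ} (hμ : 0 < μ) (hr : 0 < r)
    (ht : 0 ≤ t) :
    IntervalIntegrable (fun s : ℝ => (t - s) ^ (μ - 1) * Real.exp (r * s)) volume 0 t := by
  have h : IntervalIntegrable (fun u : ℝ => u ^ (μ - 1) * Real.exp (-(r * u))) volume 0 t := by
    rw [intervalIntegrable_iff_integrableOn_Ioc_of_le ht]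
    exact (integrableOn_rpow_mul_exp_neg_mul_Ioi hμ hr).mono_set Ioc_subset_Ioi_self
  simp only [rpow_sub_mul_exp_eq]
  simpa using (h.comp_sub_left t).symm.const_mul (Real.exp (r * t))

theorem integral_rpow_sub_mul_exp_le {μ r t : ℝ} (hμ : 0 < μ) (hr : 0 < r) (ht : 0 ≤ t) :
    ∫ s in (0 : ℝ)..t, (t - s) ^ (μ - 1) * Real.exp (r * s) ≤
      Real.exp (r * t) * (r ^ (-μ) * Real.Gamma μ) := by
  simp only [rpow_sub_mul_exp_eq]
  rw [intervalIntegral.integral_const_mul, intervalIntegral.integral_comp_sub_left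
    (fun u : ℝ => u ^ (μ - 1) * Real.exp (-(r * u)))]
  gcongr
  rw [sub_self, sub_zero, intervalIntegral.integral_of_le ht, Real.rpow_neg hr.le,
    ← Real.inv_rpow hr.le, ← one_div, ← Real.integral_rpow_mul_exp_neg_mul_Ioi hμ hr]
  refine setIntegral_mono_set (integrableOn_rpow_mul_exp_neg_mul_Ioi hμ hr) ?_
    (Ioc_subset_Ioi_self.eventuallyLE)
  refine (ae_restrict_iff' measurableSet_Ioi).2 (.of_forall fun u hu => ?_)
  have hu : (0 : ℝ) < u := hu
  simp only [Pi.zero_apply]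
  positivity

/-- The contraction estimate in the exponentially weighted norm
`‖x‖_r = sup_{t ∈ (0,T]} t^(1-λ) e^(-rt) ‖x t‖` for the solution map
`(𝒢x)(t) = S(t)x₀ + ∫₀ᵗ (t-s)^(μ-1) P(t-s) g(s, x(s)) ds`, together with the consequence
that `𝒢` is a `1/2`-contraction when `r^μ > 2 M L T^(1-λ)`. -/
theorem stmt2
    {E : Type*} [NormedAddCommGroup E] [NormedSpace ℝ E] [CompleteSpace E]
    (T μ lam M L : ℝ) (hT : 0 < T) (hμ0 : 0 < μ) (hμ1 : μ < 1)
    (hlam0 : 0 < lam) (hlam1 : lam ≤ 1) (hM : 0 < M) (hL : 0 < L)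
    (x₀ : E) (S P : ℝ → E →L[ℝ] E)
    (hScont : ∀ x : E, ContinuousOn (fun t => S t x) (Set.Ioc 0 T))
    (hPcont : ∀ x : E, ContinuousOn (fun t => P t x) (Set.Icc 0 T))
    (hSbound : ∀ t ∈ Set.Ioc (0:ℝ) T, ‖S t‖ ≤ M * t ^ (lam - 1) / Real.Gamma lam)
    (hPbound : ∀ t ∈ Set.Icc (0:ℝ) T, ‖P t‖ ≤ M / Real.Gamma μ)
    (g : ℝ → E → E)
    (hgmeas : ∀ x : E, StronglyMeasurable (fun t => g t x))
    (hgcont : ∀ t ∈ Set.Icc (0:ℝ) T, Continuous (fun x => g t x))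
    (hLip : ∀ t ∈ Set.Icc (0:ℝ) T, ∀ x y : E,
      ‖g t x - g t y‖ ≤ L * t ^ (1 - lam) * ‖x - y‖)
    (xc yc x y : ℝ → E)
    (hxc : ContinuousOn xc (Set.Icc 0 T)) (hyc : ContinuousOn yc (Set.Icc 0 T))
    (hx : ∀ t, x t = t ^ (lam - 1) • xc t) (hy : ∀ t, y t = t ^ (lam - 1) • yc t)
    (Gx Gy : ℝ → E)
    (hGx : ∀ t, Gx t = S t x₀ + ∫ s in (0:ℝ)..t, ((t - s) ^ (μ - 1)) • P (t - s) (g s (x s)))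
    (hGy : ∀ t, Gy t = S t x₀ + ∫ s in (0:ℝ)..t, ((t - s) ^ (μ - 1)) • P (t - s) (g s (y s)))
    (r : ℝ) (hr : 0 < r) :
    (⨆ t : Set.Ioc (0:ℝ) T, (t : ℝ) ^ (1 - lam) * Real.exp (-r * t) * ‖Gx t - Gy t‖)
      ≤ M * L * T ^ (1 - lam) * r ^ (-μ) *
        ⨆ t : Set.Ioc (0:ℝ) T, (t : ℝ) ^ (1 - lam) * Real.exp (-r * t) * ‖x t - y t‖ ∧
    (2 * M * L * T ^ (1 - lam) < r ^ μ →
      (⨆ t : Set.Ioc (0:ℝ) T, (t : ℝ) ^ (1 - lam) * Real.exp (-r * t) * ‖Gx t - Gy t‖)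
        ≤ (1 / 2) *
          ⨆ t : Set.Ioc (0:ℝ) T, (t : ℝ) ^ (1 - lam) * Real.exp (-r * t) * ‖x t - y t‖) := by
  have hΓ := Real.Gamma_pos_of_pos hμ0
  have hweight : ∀ t, 0 < t → t ^ (1 - lam) * ‖x t - y t‖ = ‖xc t - yc t‖ := by
    intro t ht
    have h1 : t ^ (1 - lam) * t ^ (lam - 1) = 1 := by
      rw [← Real.rpow_add ht]
      simp
    rw [hx, hy, ← smul_sub, norm_smul, Real.norm_of_nonneg (by positivity), ← mul_assoc, h1,
      one_mul]
  set K := ⨆ t : Set.Ioc (0:ℝ) T, (t : ℝ) ^ (1 - lam) * Real.exp (-r * t) * ‖x t - y t‖ with hK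
  have hK0 : 0 ≤ K := Real.iSup_nonneg fun t => by
    have := t.2.1
    positivity
  have hbdd : BddAbove (range fun t : Set.Ioc (0:ℝ) T =>
      (t : ℝ) ^ (1 - lam) * Real.exp (-r * t) * ‖x t - y t‖) := by
    obtain ⟨C, hC⟩ := isCompact_Icc.exists_bound_of_continuousOn (hxc.sub hyc)
    refine ⟨C, ?_⟩
    rintro _ ⟨⟨t, ht0, htT⟩, rfl⟩
    have hexp : Real.exp (-r * t) ≤ 1 := Real.exp_le_one_iff.2 (by nlinarith)
    calc t ^ (1 - lam) * Real.exp (-r * t) * ‖x t - y t‖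
        = Real.exp (-r * t) * ‖xc t - yc t‖ := by rw [← hweight t ht0]; ring
      _ ≤ 1 * ‖xc t - yc t‖ := by gcongr
      _ ≤ C := by simpa using hC t ⟨ht0.le, htT⟩
  have hdiff : ∀ s ∈ Ioc 0 T, ‖xc s - yc s‖ ≤ K * Real.exp (r * s) := by
    intro s hs
    have h := le_ciSup hbdd ⟨s, hs⟩
    rw [← hK] at h
    dsimp only at h
    rw [mul_right_comm, hweight s hs.1] at h
    calc ‖xc s - yc s‖ = ‖xc s - yc s‖ * Real.exp (-r * s) * Real.exp (r * s) := by
          rw [mul_assoc, ← Real.exp_add]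
          simp
      _ ≤ K * Real.exp (r * s) := by gcongr
  have hgdiff : ∀ s ∈ Ioc 0 T, ‖g s (x s) - g s (y s)‖ ≤ L * (K * Real.exp (r * s)) := by
    intro s hs
    refine (hLip s ⟨hs.1.le, hs.2⟩ _ _).trans ?_
    rw [mul_assoc, hweight s hs.1]
    gcongr
    exact hdiff s hs
  have hgm : ∀ t ∈ Ioc 0 T, ∀ z zc : ℝ → E, ContinuousOn zc (Icc 0 T) →
      (∀ s, z s = s ^ (lam - 1) • zc s) →
      AEStronglyMeasurable (fun s => g s (z s)) (volume.restrict (Ioo 0 t)) := by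
    intro t ht z zc hzc hz
    have hsub : Ioo 0 t ⊆ Icc 0 T := fun s hs => ⟨hs.1.le, hs.2.le.trans ht.2⟩
    refine aestronglyMeasurable_caratheodory_comp (fun e => (hgmeas e).aestronglyMeasurable)
      ((ae_restrict_iff' measurableSet_Ioo).2 (.of_forall fun s hs => hgcont s (hsub hs))) ?_
    rw [funext hz]
    exact (by fun_prop : Measurable fun s : ℝ => s ^ (lam - 1)).aestronglyMeasurable.smul
      ((hzc.mono hsub).aestronglyMeasurable measurableSet_Ioo)
  have hpoint : ∀ t ∈ Ioc 0 T, ‖Gx t - Gy t‖ ≤ M * L * K * (Real.exp (r * t) * r ^ (-μ)) := by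
    intro t ht
    rw [hGx, hGy, add_sub_add_left_eq_sub]
    have hmaps : MapsTo (fun s => t - s) (Ioo 0 t) (Icc 0 T) := fun s hs =>
      ⟨sub_nonneg.2 hs.2.le, by linarith [hs.1, ht.2]⟩
    have hm : AEStronglyMeasurable (fun s => (t - s) ^ (μ - 1) • P (t - s) (g s (x s)) -
        (t - s) ^ (μ - 1) • P (t - s) (g s (y s))) (volume.restrict (Ioo 0 t)) := by
      simp only [← smul_sub, ← map_sub]
      refine (by fun_prop : Measurable fun s : ℝ => (t - s) ^ (μ - 1)).aestronglyMeasurable.smul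
        (aestronglyMeasurable_caratheodory_comp (u := fun s e => P (t - s) e) (fun e => ?_)
          (.of_forall fun s => (P (t - s)).continuous)
          ((hgm t ht x xc hxc hx).sub (hgm t ht y yc hyc hy)))
      exact ((hPcont e).comp (by fun_prop) hmaps).aestronglyMeasurable measurableSet_Ioo
    refine (norm_intervalIntegral_sub_le_of_norm_sub_le ht.1.le hm
      ((intervalIntegrable_rpow_sub_mul_exp hμ0 hr ht.1.le).const_mul
        (M / Real.Gamma μ * L * K)) fun s hs => ?_).trans ?_
    · have hts : 0 < t - s := sub_pos.2 hs.2
      rw [← smul_sub, ← map_sub, norm_smul, Real.norm_of_nonneg (by positivity)]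
      calc (t - s) ^ (μ - 1) * ‖P (t - s) (g s (x s) - g s (y s))‖
          ≤ (t - s) ^ (μ - 1) * (M / Real.Gamma μ * (L * (K * Real.exp (r * s)))) := by
            gcongr
            exact (P (t - s)).le_of_opNorm_le_of_le (hPbound _ (hmaps hs))
              (hgdiff s ⟨hs.1, hs.2.le.trans ht.2⟩)
        _ = _ := by ring
    · rw [intervalIntegral.integral_const_mul]
      calc _ ≤ M / Real.Gamma μ * L * K * (Real.exp (r * t) * (r ^ (-μ) * Real.Gamma μ)) := by
            gcongr
            exact integral_rpow_sub_mul_exp_le hμ0 hr ht.1.le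
        _ = _ := by field_simp
  have hmain : (⨆ t : Set.Ioc (0:ℝ) T, (t : ℝ) ^ (1 - lam) * Real.exp (-r * t) * ‖Gx t - Gy t‖)
      ≤ M * L * T ^ (1 - lam) * r ^ (-μ) * K := by
    refine Real.iSup_le (fun ⟨t, ht⟩ => ?_) (by positivity)
    have ht0 := ht.1
    calc t ^ (1 - lam) * Real.exp (-r * t) * ‖Gx t - Gy t‖
        ≤ T ^ (1 - lam) * Real.exp (-r * t) *
            (M * L * K * (Real.exp (r * t) * r ^ (-μ))) := by
          gcongr
          · exact ht.2
          · exact hpoint t ht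
      _ = M * L * T ^ (1 - lam) * r ^ (-μ) * K * (Real.exp (-r * t) * Real.exp (r * t)) := by
          ring
      _ = M * L * T ^ (1 - lam) * r ^ (-μ) * K := by
          rw [← Real.exp_add]
          simp
  refine ⟨hmain, fun hlarge => hmain.trans ?_⟩
  gcongr
  rw [Real.rpow_neg hr.le, ← div_eq_mul_inv, div_le_iff₀ (by positivity)]
  linarith
end

section
/- Let $T>0$, $\mu>0$, $a\ge 0$, $b\ge 0$, and let $u:[0,T]\to\mathbb R$ be a continuous nonnegative function satisfying $u(t)\le a + b\int_0^t (t-s)^{\mu-1}u(s)\,ds$ for all $t\in[0,T]$. Then for all $t\in[0,T]$, $u(t)\le a\,\sum_{n=0}^{\infty} \frac{(b\,\Gamma(\mu))^{n}\,t^{n\mu}}{\Gamma(n\mu+1)}$. -/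
open MeasureTheory

/-- Euler's beta integral on `[0, t]`, in terms of the real Gamma function. -/
theorem integral_sub_rpow_mul_rpow {t α β : ℝ} (ht : 0 < t) (hα : 0 < α) (hβ : 0 < β) :
    ∫ s in (0:ℝ)..t, (t - s) ^ (α - 1) * s ^ (β - 1) =
      t ^ (α + β - 1) * (Real.Gamma α * Real.Gamma β / Real.Gamma (α + β)) := by
  have h := Complex.betaIntegral_scaled β α ht
  rw [Complex.betaIntegral_eq_Gamma_mul_div _ _ (by simpa) (by simpa)] at h
  apply Complex.ofReal_injective
  rw [← intervalIntegral.integral_ofReal]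
  calc ∫ s in (0:ℝ)..t, (((t - s) ^ (α - 1) * s ^ (β - 1) : ℝ) : ℂ)
      = ∫ s in (0:ℝ)..t, (s : ℂ) ^ ((β : ℂ) - 1) * ((t : ℂ) - s) ^ ((α : ℂ) - 1) := by
        refine intervalIntegral.integral_congr fun s hs ↦ ?_
        rw [Set.uIcc_of_le ht.le] at hs
        rw [Complex.ofReal_mul, Complex.ofReal_cpow (sub_nonneg.2 hs.2),
          Complex.ofReal_cpow hs.1, mul_comm]
        push_cast
        rfl
    _ = _ := by
        rw [h, Complex.ofReal_mul, Complex.ofReal_cpow ht.le]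
        push_cast [Complex.Gamma_ofReal]
        rw [add_comm (β : ℂ) α, ← Complex.ofReal_add, Complex.Gamma_ofReal]
        push_cast
        ring

/-- The kernel `(t - s) ^ (μ - 1)` is integrable against continuous functions. -/
theorem intervalIntegrable_sub_rpow_mul {t μ : ℝ} (hμ : 0 < μ) (ht : 0 ≤ t) {f : ℝ → ℝ}
    (hf : ContinuousOn f (Set.Icc 0 t)) :
    IntervalIntegrable (fun s ↦ (t - s) ^ (μ - 1) * f s) volume 0 t := by
  have h : IntervalIntegrable (fun x : ℝ ↦ x ^ (μ - 1)) volume 0 t :=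
    intervalIntegral.intervalIntegrable_rpow' (by linarith)
  have h' := (h.comp_sub_left t).symm
  simp only [sub_zero, sub_self] at h'
  exact h'.mul_continuousOn (by rwa [Set.uIcc_of_le ht])

theorem rpow_mul_exp_neg_le_Gamma_add_one {x R : ℝ} (hx : 0 ≤ x) (hR : 0 < R) :
    R ^ x * Real.exp (-R) ≤ Real.Gamma (x + 1) := by
  have hint := Real.GammaIntegral_convergent (s := x + 1) (by linarith)
  have hsub : Set.Ioi R ⊆ Set.Ioi 0 := Set.Ioi_subset_Ioi hR.le
  rw [Real.Gamma_eq_integral (by linarith), ← integral_exp_neg_Ioi, ← integral_const_mul]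
  calc ∫ y in Set.Ioi R, R ^ x * Real.exp (-y)
      ≤ ∫ y in Set.Ioi R, Real.exp (-y) * y ^ (x + 1 - 1) := by
        refine setIntegral_mono_on ((integrableOn_exp_neg_Ioi R).const_mul _)
          (hint.mono_set hsub) measurableSet_Ioi fun y hy ↦ ?_
        rw [add_sub_cancel_right, mul_comm]
        have hy : R < y := hy
        gcongr
    _ ≤ ∫ y in Set.Ioi 0, Real.exp (-y) * y ^ (x + 1 - 1) := by
        refine setIntegral_mono_set hint ?_ hsub.eventuallyLE
        filter_upwards [ae_restrict_mem measurableSet_Ioi] with y hy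
        have hy : 0 < y := hy
        simp only [Pi.zero_apply]
        positivity

/-- The Mittag-Leffler series converges at every nonnegative argument. -/
theorem summable_pow_div_Gamma {μ z : ℝ} (hμ : 0 < μ) (hz : 0 ≤ z) :
    Summable fun n : ℕ ↦ z ^ n / Real.Gamma ((n : ℝ) * μ + 1) := by
  have hw : 0 < 2 * z + 1 := by linarith
  set R : ℝ := (2 * z + 1) ^ μ⁻¹ with hRdef
  have hR : 0 < R := Real.rpow_pos_of_pos hw _
  have hRpow (n : ℕ) : R ^ ((n : ℝ) * μ) = (2 * z + 1) ^ n := by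
    rw [hRdef, ← Real.rpow_mul hw.le, mul_comm (n : ℝ), inv_mul_cancel_left₀ hμ.ne',
      Real.rpow_natCast]
  have hgeom : Summable fun n : ℕ ↦ (z / (2 * z + 1)) ^ n :=
    summable_geometric_of_lt_one (by positivity) (by rw [div_lt_one hw]; linarith)
  refine (hgeom.mul_left (Real.exp R)).of_nonneg_of_le (fun n ↦ ?_) fun n ↦ ?_
  · have := Real.Gamma_pos_of_pos (s := (n : ℝ) * μ + 1) (by positivity)
    positivity
  · have h := rpow_mul_exp_neg_le_Gamma_add_one (x := (n : ℝ) * μ) (by positivity) hR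
    rw [hRpow] at h
    calc z ^ n / Real.Gamma ((n : ℝ) * μ + 1)
        ≤ z ^ n / ((2 * z + 1) ^ n * Real.exp (-R)) := by gcongr
      _ = Real.exp R * (z / (2 * z + 1)) ^ n := by
        rw [Real.exp_neg, div_pow]
        field_simp

/-- The `n`-th term of the series `E_μ (b Γ(μ) t ^ μ)`. -/
noncomputable def mittagLefflerTerm (b μ : ℝ) (n : ℕ) (t : ℝ) : ℝ :=
  (b * Real.Gamma μ) ^ n * t ^ ((n : ℝ) * μ) / Real.Gamma ((n : ℝ) * μ + 1)

theorem summable_mittagLefflerTerm {b μ t : ℝ} (hb : 0 ≤ b) (hμ : 0 < μ) (ht : 0 ≤ t) :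
    Summable fun n ↦ mittagLefflerTerm b μ n t := by
  have hΓ := Real.Gamma_pos_of_pos hμ
  refine (summable_pow_div_Gamma (z := b * Real.Gamma μ * t ^ μ) hμ (by positivity)).congr
    fun n ↦ ?_
  rw [mittagLefflerTerm, mul_pow, mul_comm (n : ℝ), Real.rpow_mul_natCast ht]

theorem continuous_mittagLefflerTerm {b μ : ℝ} (hμ : 0 < μ) (n : ℕ) :
    Continuous (mittagLefflerTerm b μ n) :=
  ((Real.continuous_rpow_const (by positivity)).const_mul _).div_const _

/-- The fractional integral operator shifts the terms of the Mittag-Leffler series. -/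
theorem mul_integral_mittagLefflerTerm {b μ t : ℝ} (hμ : 0 < μ) (ht : 0 ≤ t) (n : ℕ) :
    b * ∫ s in (0:ℝ)..t, (t - s) ^ (μ - 1) * mittagLefflerTerm b μ n s =
      mittagLefflerTerm b μ (n + 1) t := by
  rcases ht.eq_or_lt with rfl | ht
  · have : ((n : ℝ) + 1) * μ ≠ 0 := by positivity
    simp [mittagLefflerTerm, Real.zero_rpow this]
  have hΓ : Real.Gamma ((n : ℝ) * μ + 1) ≠ 0 := (Real.Gamma_pos_of_pos (by positivity)).ne'
  have h := integral_sub_rpow_mul_rpow (β := (n : ℝ) * μ + 1) ht hμ (by positivity)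
  rw [add_sub_cancel_right] at h
  have hfun (s : ℝ) : (t - s) ^ (μ - 1) * mittagLefflerTerm b μ n s =
      (b * Real.Gamma μ) ^ n / Real.Gamma ((n : ℝ) * μ + 1) *
        ((t - s) ^ (μ - 1) * s ^ ((n : ℝ) * μ)) := by
    rw [mittagLefflerTerm]
    ring
  simp_rw [hfun]
  rw [intervalIntegral.integral_const_mul, h, mittagLefflerTerm]
  have e₁ : μ + ((n : ℝ) * μ + 1) - 1 = ((n + 1 : ℕ) : ℝ) * μ := by push_cast; ring
  have e₂ : μ + ((n : ℝ) * μ + 1) = ((n + 1 : ℕ) : ℝ) * μ + 1 := by push_cast; ring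
  rw [e₁, e₂]
  field_simp
  ring

/-- Iterating the integral inequality `n` times. -/
theorem le_sum_mittagLefflerTerm_add {T μ a b M : ℝ} (hμ : 0 < μ) (hb : 0 ≤ b) {u : ℝ → ℝ}
    (hu_cont : ContinuousOn u (Set.Icc 0 T)) (hM : ∀ t ∈ Set.Icc (0:ℝ) T, u t ≤ M)
    (hu : ∀ t ∈ Set.Icc (0:ℝ) T,
      u t ≤ a + b * ∫ s in (0:ℝ)..t, (t - s) ^ (μ - 1) * u s) (n : ℕ) :
    ∀ t ∈ Set.Icc (0:ℝ) T,
      u t ≤ a * ∑ k ∈ Finset.range n, mittagLefflerTerm b μ k t +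
        M * mittagLefflerTerm b μ n t := by
  induction n with
  | zero => simpa [mittagLefflerTerm] using hM
  | succ n ih =>
    intro t ht
    have hint (k : ℕ) := intervalIntegrable_sub_rpow_mul hμ ht.1
      (continuous_mittagLefflerTerm (b := b) hμ k).continuousOn
    have hsum : IntervalIntegrable (fun s ↦ ∑ k ∈ Finset.range n,
        (t - s) ^ (μ - 1) * mittagLefflerTerm b μ k s) volume 0 t := by
      simpa only [Finset.sum_fn] using IntervalIntegrable.sum (Finset.range n) fun k _ ↦ hint k
    calc u t ≤ a + b * ∫ s in (0:ℝ)..t, (t - s) ^ (μ - 1) * u s := hu t ht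
      _ ≤ a + b * ∫ s in (0:ℝ)..t,
          (a * ∑ k ∈ Finset.range n, (t - s) ^ (μ - 1) * mittagLefflerTerm b μ k s +
            M * ((t - s) ^ (μ - 1) * mittagLefflerTerm b μ n s)) := by
        gcongr
        refine intervalIntegral.integral_mono_on ht.1
          (intervalIntegrable_sub_rpow_mul hμ ht.1
            (hu_cont.mono (Set.Icc_subset_Icc_right ht.2)))
          ((hsum.const_mul _).add ((hint n).const_mul _)) fun s hs ↦ ?_
        have h := mul_le_mul_of_nonneg_left (ih s ⟨hs.1, hs.2.trans ht.2⟩)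
          (Real.rpow_nonneg (sub_nonneg.2 hs.2) (μ - 1))
        rw [← Finset.mul_sum]
        linarith
      _ = a * ∑ k ∈ Finset.range (n + 1), mittagLefflerTerm b μ k t +
          M * mittagLefflerTerm b μ (n + 1) t := by
        rw [intervalIntegral.integral_add (hsum.const_mul _) ((hint n).const_mul _),
          intervalIntegral.integral_const_mul, intervalIntegral.integral_const_mul,
          intervalIntegral.integral_finsetSum fun k _ ↦ hint k, Finset.sum_range_succ']
        simp_rw [← mul_integral_mittagLefflerTerm hμ ht.1, ← Finset.mul_sum]
        have h0 : mittagLefflerTerm b μ 0 t = 1 := by simp [mittagLefflerTerm]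
        rw [h0]
        ring

/-- Fractional Gronwall inequality: if a continuous nonnegative `u` satisfies
`u t ≤ a + b ∫₀ᵗ (t-s)^(μ-1) u s ds` on `[0,T]`, then
`u t ≤ a ∑_{n} (b Γ(μ))^n t^(nμ) / Γ(nμ+1)` (a Mittag-Leffler bound). -/
theorem stmt6
    (T μ a b : ℝ) (hT : 0 < T) (hμ : 0 < μ) (ha : 0 ≤ a) (hb : 0 ≤ b)
    (u : ℝ → ℝ) (hu_cont : ContinuousOn u (Set.Icc 0 T))
    (hu_nonneg : ∀ t ∈ Set.Icc (0:ℝ) T, 0 ≤ u t)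
    (hu : ∀ t ∈ Set.Icc (0:ℝ) T,
      u t ≤ a + b * ∫ s in (0:ℝ)..t, (t - s) ^ (μ - 1) * u s) :
    ∀ t ∈ Set.Icc (0:ℝ) T,
      u t ≤ a * ∑' n : ℕ,
        (b * Real.Gamma μ) ^ n * t ^ ((n : ℝ) * μ) / Real.Gamma ((n : ℝ) * μ + 1) := by
  intro t ht
  obtain ⟨M, hM⟩ := isCompact_Icc.bddAbove_image hu_cont
  have hbound := fun n ↦ le_sum_mittagLefflerTerm_add hμ hb hu_cont
    (fun s hs ↦ hM (Set.mem_image_of_mem u hs)) hu n t ht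
  have hsummable := summable_mittagLefflerTerm hb hμ ht.1
  have hlim := (hsummable.hasSum.tendsto_sum_nat.const_mul a).add
    (hsummable.tendsto_atTop_zero.const_mul M)
  rw [mul_zero, add_zero] at hlim
  exact ge_of_tendsto' hlim hbound
end
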